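/- arXiv:1412.0815 — 5 statements merged into one kernel-verified Lean document; each statement's English description precedes it below -/
import Mathlib

section
/- Let (b,c) be a connected graph over a countably infinite set X. Then: (1) for each o ∈ X the map γ_o : X × X → [0,∞) is a metric on X, and so is γ : X × X → [0,∞); (2) every f ∈ D₀ satisfies |f(x) − f(y)| ≤ Q(f)^{1/2} · γ(x,y) for all x,y ∈ X; (3) γ_o ≤ γ for every o ∈ X, and γ(x,y) = sup_{o∈X} γ_o(x,y) for all x,y ∈ X. -/
open ENNReal Filter Topology

namespace UTGraph

variable {X : Type*}

/-- A graph over `X`: symmetric nonnegative edge weight `b` with zero diagonal and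
summable rows, together with a nonnegative potential (killing term) `c`. -/
structure IsGraph (b : X → X → ℝ) (c : X → ℝ) : Prop where
  symm : ∀ x y, b x y = b y x
  nonneg : ∀ x y, 0 ≤ b x y
  loopless : ∀ x, b x x = 0
  row_summable : ∀ x, Summable fun y => b x y
  c_nonneg : ∀ x, 0 ≤ c x

/-- Connectedness: any two vertices are joined by a path of positive edge weights. -/
def Connected (b : X → X → ℝ) : Prop :=
  ∀ x y : X, Relation.ReflTransGen (fun u v => 0 < b u v) x y

/-- The energy form `Q(f)`, with values in `[0,∞]`. -/
noncomputable def energy (b : X → X → ℝ) (c : X → ℝ) (f : X → ℝ) : ℝ≥0∞ :=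
  (1 / 2) * ∑' p : X × X, ENNReal.ofReal (b p.1 p.2 * (f p.1 - f p.2) ^ 2)
    + ∑' x, ENNReal.ofReal (c x * f x ^ 2)

/-- `f` has finite energy, i.e. `f ∈ D`. -/
def FiniteEnergy (b : X → X → ℝ) (c : X → ℝ) (f : X → ℝ) : Prop :=
  energy b c f < ⊤

/-- The bilinear energy form `Q(f,g)` (for finite-energy functions). -/
noncomputable def energyBilin (b : X → X → ℝ) (c : X → ℝ) (f g : X → ℝ) : ℝ :=
  (1 / 2) * ∑' p : X × X, b p.1 p.2 * (f p.1 - f p.2) * (g p.1 - g p.2)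
    + ∑' x, c x * f x * g x

/-- `f ∈ C_c(X)`: finitely supported function. -/
def FinSupp (f : X → ℝ) : Prop := (Function.support f).Finite

/-- The norm `‖f‖_o = (Q(f) + f(o)²)^{1/2}`. -/
noncomputable def normO (b : X → X → ℝ) (c : X → ℝ) (o : X) (f : X → ℝ) : ℝ :=
  Real.sqrt ((energy b c f).toReal + f o ^ 2)

/-- `f ∈ D₀`: there is a sequence of finitely supported functions converging to `f`
pointwise whose energy difference to `f` tends to `0`. -/
def MemD0 (b : X → X → ℝ) (c : X → ℝ) (f : X → ℝ) : Prop :=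
  ∃ φ : ℕ → X → ℝ, (∀ n, FinSupp (φ n)) ∧
    (∀ x, Tendsto (fun n => φ n x) atTop (𝓝 (f x))) ∧
    Tendsto (fun n => energy b c (φ n - f)) atTop (𝓝 0)

/-- `f ∈ C₀(X)`: `f` belongs to the uniform closure of the finitely supported functions,
i.e. for every `ε > 0` the set where `|f| ≥ ε` is finite. -/
def MemC0 (f : X → ℝ) : Prop := ∀ ε : ℝ, 0 < ε → {x | ε ≤ |f x|}.Finite

/-- The graph is uniformly transient: `D₀ ⊆ C₀(X)`. -/
def UniformlyTransient (b : X → X → ℝ) (c : X → ℝ) : Prop :=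
  ∀ f : X → ℝ, MemD0 b c f → MemC0 f

/-- The capacity of a point: `cap(x) = inf {Q(φ) : φ ∈ C_c(X), φ(x) = 1}`. -/
noncomputable def cap (b : X → X → ℝ) (c : X → ℝ) (x : X) : ℝ≥0∞ :=
  ⨅ (φ : X → ℝ) (_ : FinSupp φ) (_ : φ x = 1), energy b c φ

/-- `f ∈ F`: the domain of the formal Laplacian. -/
def MemF (b : X → X → ℝ) (f : X → ℝ) : Prop :=
  ∀ x, Summable fun y => b x y * |f y|

/-- The formal Laplacian `𝓛 f (x) = Σ_y b(x,y)(f(x) - f(y)) + c(x) f(x)`. -/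
noncomputable def formalLaplacian (b : X → X → ℝ) (c : X → ℝ) (f : X → ℝ) (x : X) : ℝ :=
  (∑' y, b x y * (f x - f y)) + c x * f x

/-- `f` is harmonic: `f ∈ F` and `𝓛 f = 0`. -/
def Harmonic (b : X → X → ℝ) (c : X → ℝ) (f : X → ℝ) : Prop :=
  MemF b f ∧ ∀ x, formalLaplacian b c f x = 0

/-- The graph is recurrent: the constant function `1` lies in `D₀` and `Q(1) = 0`. -/
def Recurrent (b : X → X → ℝ) (c : X → ℝ) : Prop :=
  MemD0 b c 1 ∧ energy b c 1 = 0

/-- The graph is transient: not recurrent. -/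
def Transient (b : X → X → ℝ) (c : X → ℝ) : Prop := ¬ Recurrent b c

/-- The metric `γ_o`. -/
noncomputable def gammaO (b : X → X → ℝ) (c : X → ℝ) (o x y : X) : ℝ :=
  sSup {d : ℝ | ∃ φ : X → ℝ, FinSupp φ ∧
    energy b c φ + ENNReal.ofReal (φ o ^ 2) ≤ 1 ∧ d = |φ x - φ y|}

/-- The metric `γ`. -/
noncomputable def gamma (b : X → X → ℝ) (c : X → ℝ) (x y : X) : ℝ :=
  sSup {d : ℝ | ∃ φ : X → ℝ, FinSupp φ ∧ energy b c φ ≤ 1 ∧ d = |φ x - φ y|}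

/-- `d` is a metric on `X`. -/
def IsMetric (d : X → X → ℝ) : Prop :=
  (∀ x y, 0 ≤ d x y) ∧ (∀ x y, d x y = d y x) ∧
  (∀ x y, d x y = 0 ↔ x = y) ∧ (∀ x y z, d x z ≤ d x y + d y z)

/-- `f` belongs to the closure of `C_c(X)` with respect to the norm
`‖·‖_Q = (Q(·) + ‖·‖_m²)^{1/2}` inside `D ∩ ℓ²(X,m)`. -/
def MemFormDomain (b : X → X → ℝ) (c : X → ℝ) (m : X → ℝ) (f : X → ℝ) : Prop :=
  FiniteEnergy b c f ∧ Summable (fun x => m x * f x ^ 2) ∧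
  ∃ φ : ℕ → X → ℝ, (∀ n, FinSupp (φ n)) ∧
    Tendsto (fun n => energy b c (f - φ n)
      + ∑' x, ENNReal.ofReal (m x * (f x - φ n x) ^ 2)) atTop (𝓝 0)

end UTGraph

namespace UTGraph

section

variable {X : Type*} {b : X → X → ℝ} {c : X → ℝ}

lemma energy_zero : energy b c 0 = 0 := by
  simp [energy]

lemma energy_smul (t : ℝ) (f : X → ℝ) :
    energy b c (t • f) = ENNReal.ofReal (t ^ 2) * energy b c f := by
  have hb : ∀ p : X × X, ENNReal.ofReal (b p.1 p.2 * ((t • f) p.1 - (t • f) p.2) ^ 2)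
      = ENNReal.ofReal (t ^ 2) * ENNReal.ofReal (b p.1 p.2 * (f p.1 - f p.2) ^ 2) := fun p => by
    rw [← ENNReal.ofReal_mul (sq_nonneg t)]
    congr 1
    simp only [Pi.smul_apply, smul_eq_mul]
    ring
  have hc : ∀ x, ENNReal.ofReal (c x * (t • f) x ^ 2)
      = ENNReal.ofReal (t ^ 2) * ENNReal.ofReal (c x * f x ^ 2) := fun x => by
    rw [← ENNReal.ofReal_mul (sq_nonneg t)]
    congr 1
    simp only [Pi.smul_apply, smul_eq_mul]
    ring
  simp only [energy, hb, hc, ENNReal.tsum_mul_left]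
  ring

lemma energy_neg (f : X → ℝ) : energy b c (-f) = energy b c f := by
  simpa using energy_smul (b := b) (c := c) (-1) f

lemma sq_add_le_weighted {ε : ℝ} (hε : 0 < ε) (u v : ℝ) :
    (u + v) ^ 2 ≤ (1 + ε) * u ^ 2 + (1 + ε⁻¹) * v ^ 2 := by
  have h : (1 + ε) * u ^ 2 + (1 + ε⁻¹) * v ^ 2 - (u + v) ^ 2 = ε⁻¹ * (ε * u - v) ^ 2 := by
    field_simp
    ring
  have : 0 ≤ ε⁻¹ * (ε * u - v) ^ 2 := by positivity
  linarith

lemma ofReal_mul_sq_add_le {ε w : ℝ} (hε : 0 < ε) (hw : 0 ≤ w) (u v : ℝ) :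
    ENNReal.ofReal (w * (u + v) ^ 2) ≤ ENNReal.ofReal (1 + ε) * ENNReal.ofReal (w * u ^ 2)
      + ENNReal.ofReal (1 + ε⁻¹) * ENNReal.ofReal (w * v ^ 2) := by
  rw [← ENNReal.ofReal_mul (by positivity), ← ENNReal.ofReal_mul (by positivity),
    ← ENNReal.ofReal_add (by positivity) (by positivity)]
  apply ENNReal.ofReal_le_ofReal
  calc w * (u + v) ^ 2 ≤ w * ((1 + ε) * u ^ 2 + (1 + ε⁻¹) * v ^ 2) :=
        mul_le_mul_of_nonneg_left (sq_add_le_weighted hε u v) hw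
    _ = _ := by ring

/-- Young's inequality for the energy form. -/
lemma IsGraph.energy_add_le (hg : IsGraph b c) {ε : ℝ} (hε : 0 < ε) (f g : X → ℝ) :
    energy b c (f + g)
      ≤ ENNReal.ofReal (1 + ε) * energy b c f + ENNReal.ofReal (1 + ε⁻¹) * energy b c g := by
  have hb : ∀ p : X × X, ENNReal.ofReal (b p.1 p.2 * ((f + g) p.1 - (f + g) p.2) ^ 2)
      ≤ ENNReal.ofReal (1 + ε) * ENNReal.ofReal (b p.1 p.2 * (f p.1 - f p.2) ^ 2)
        + ENNReal.ofReal (1 + ε⁻¹) * ENNReal.ofReal (b p.1 p.2 * (g p.1 - g p.2) ^ 2) := by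
    intro p
    rw [Pi.add_apply, Pi.add_apply, add_sub_add_comm]
    exact ofReal_mul_sq_add_le hε (hg.nonneg _ _) _ _
  have hc : ∀ x, ENNReal.ofReal (c x * (f + g) x ^ 2)
      ≤ ENNReal.ofReal (1 + ε) * ENNReal.ofReal (c x * f x ^ 2)
        + ENNReal.ofReal (1 + ε⁻¹) * ENNReal.ofReal (c x * g x ^ 2) :=
    fun x => ofReal_mul_sq_add_le hε (hg.c_nonneg x) _ _
  have hb' := ENNReal.tsum_le_tsum hb
  have hc' := ENNReal.tsum_le_tsum hc
  rw [ENNReal.tsum_add, ENNReal.tsum_mul_left, ENNReal.tsum_mul_left] at hb' hc'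
  unfold energy
  refine (add_le_add (mul_le_mul_right hb' _) hc').trans (le_of_eq ?_)
  ring

lemma IsGraph.energy_add_lt_top (hg : IsGraph b c) {f g : X → ℝ}
    (hf : energy b c f < ⊤) (hgE : energy b c g < ⊤) : energy b c (f + g) < ⊤ :=
  (hg.energy_add_le one_pos f g).trans_lt <| ENNReal.add_lt_top.2
    ⟨ENNReal.mul_lt_top ENNReal.ofReal_lt_top hf, ENNReal.mul_lt_top ENNReal.ofReal_lt_top hgE⟩

open Classical in
lemma IsGraph.energy_single_lt_top (hg : IsGraph b c) (x : X) (t : ℝ) :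
    energy b c (Pi.single x t) < ⊤ := by
  have hrow : ∑' y, ENNReal.ofReal (b x y) < ⊤ := by
    rw [← ENNReal.ofReal_tsum_of_nonneg (hg.nonneg x) (hg.row_summable x)]
    exact ENNReal.ofReal_lt_top
  have hb : ∀ p : X × X,
      ENNReal.ofReal (b p.1 p.2 *
        ((Pi.single x 1 : X → ℝ) p.1 - (Pi.single x 1 : X → ℝ) p.2) ^ 2)
      ≤ (if p.1 = x then ENNReal.ofReal (b x p.2) else 0)
        + (if p.2 = x then ENNReal.ofReal (b x p.1) else 0) := by
    rintro ⟨u, v⟩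
    by_cases hu : u = x <;> by_cases hv : v = x <;> simp [hu, hv]
    exact ENNReal.ofReal_le_ofReal (hg.symm u x).le
  have hfst : ∑' p : X × X, (if p.1 = x then ENNReal.ofReal (b x p.2) else 0)
      = ∑' y, ENNReal.ofReal (b x y) := by
    rw [ENNReal.tsum_prod', tsum_eq_single x (fun u hu => by simp [hu])]
    simp
  have hsnd : ∑' p : X × X, (if p.2 = x then ENNReal.ofReal (b x p.1) else 0)
      = ∑' y, ENNReal.ofReal (b x y) := by
    rw [ENNReal.tsum_prod']
    simp
  have hc : ∑' y, ENNReal.ofReal (c y * (Pi.single x 1 : X → ℝ) y ^ 2) < ⊤ := by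
    rw [tsum_eq_single x (fun u hu => by simp [hu])]
    exact ENNReal.ofReal_lt_top
  have hone : energy b c (Pi.single x 1) < ⊤ := by
    refine ENNReal.add_lt_top.2 ⟨ENNReal.mul_lt_top (by simp) ?_, hc⟩
    refine (ENNReal.tsum_le_tsum hb).trans_lt ?_
    rw [ENNReal.tsum_add, hfst, hsnd]
    exact ENNReal.add_lt_top.2 ⟨hrow, hrow⟩
  have hsmul : (Pi.single x t : X → ℝ) = t • Pi.single x 1 := by
    rw [← Pi.single_smul, smul_eq_mul, mul_one]
  rw [hsmul, energy_smul]
  exact ENNReal.mul_lt_top ENNReal.ofReal_lt_top hone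

lemma IsGraph.energy_lt_top_of_finSupp (hg : IsGraph b c) {φ : X → ℝ} (hφ : FinSupp φ) :
    energy b c φ < ⊤ := by
  classical
  suffices h : ∀ ψ : X →₀ ℝ, energy b c ψ < ⊤ from h (Finsupp.ofSupportFinite φ hφ)
  intro ψ
  induction ψ using Finsupp.induction_linear with
  | zero => simp [energy_zero]
  | add f g hf hgE =>
    rw [Finsupp.coe_add]
    exact hg.energy_add_lt_top hf hgE
  | single x t =>
    rw [Finsupp.single_eq_pi_single]
    exact hg.energy_single_lt_top x t

lemma finSupp_zero : FinSupp (0 : X → ℝ) := by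
  simp [FinSupp]

lemma FinSupp.smul {φ : X → ℝ} (hφ : FinSupp φ) (t : ℝ) : FinSupp (t • φ) :=
  hφ.subset (Function.support_const_smul_subset t φ)

/-- Functions of energy at most one have bounded oscillation between any two vertices. -/
lemma Connected.exists_abs_sub_le (hconn : Connected b) (x y : X) :
    ∃ C : ℝ, ∀ φ : X → ℝ, energy b c φ ≤ 1 → |φ x - φ y| ≤ C := by
  induction hconn x y with
  | refl => exact ⟨0, fun φ _ => by simp⟩
  | @tail u v _ huv ih =>
    obtain ⟨C, hC⟩ := ih
    refine ⟨C + √(2 / b u v), fun φ hφ => ?_⟩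
    have hedge : ENNReal.ofReal (1 / 2 * (b u v * (φ u - φ v) ^ 2)) ≤ ENNReal.ofReal 1 := by
      rw [ENNReal.ofReal_mul (by norm_num), ENNReal.ofReal_one]
      refine le_trans ?_ (le_self_add.trans hφ)
      have hhalf : ENNReal.ofReal (1 / 2) = 1 / 2 := by
        rw [ENNReal.ofReal_div_of_pos two_pos]
        simp
      rw [hhalf]
      exact mul_le_mul_right
        (ENNReal.le_tsum (f := fun p : X × X => ENNReal.ofReal (b p.1 p.2 * (φ p.1 - φ p.2) ^ 2))
          (u, v)) _
    rw [ENNReal.ofReal_le_ofReal_iff zero_le_one] at hedge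
    have hstep : |φ u - φ v| ≤ √(2 / b u v) := by
      apply Real.abs_le_sqrt
      rw [le_div_iff₀ huv]
      linarith
    calc |φ x - φ v| ≤ |φ x - φ u| + |φ u - φ v| := abs_sub_le _ _ _
      _ ≤ _ := add_le_add (hC φ hφ) hstep

/-- The supremum of the oscillations over a bounded separating family is a metric. -/
lemma isMetric_sSup_abs_sub {P R : (X → ℝ) → Prop} (hP : P 0) (hR : R 0)
    (hbdd : ∀ x y, BddAbove {d : ℝ | ∃ φ : X → ℝ, P φ ∧ R φ ∧ d = |φ x - φ y|})
    (hsep : ∀ x y, x ≠ y → ∃ φ, P φ ∧ R φ ∧ φ x ≠ φ y) :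
    IsMetric fun x y => sSup {d : ℝ | ∃ φ : X → ℝ, P φ ∧ R φ ∧ d = |φ x - φ y|} := by
  refine ⟨fun x y => ?_, fun x y => ?_, fun x y => ⟨fun h => ?_, fun h => ?_⟩, fun x y z => ?_⟩
  · apply Real.sSup_nonneg
    rintro _ ⟨φ, -, -, rfl⟩
    exact abs_nonneg _
  · simp only [abs_sub_comm]
  · by_contra hne
    obtain ⟨φ, hφP, hφR, hφ⟩ := hsep x y hne
    have hle := le_csSup (hbdd x y) ⟨φ, hφP, hφR, rfl⟩
    exact (abs_pos.2 (sub_ne_zero.2 hφ)).not_ge (hle.trans h.le)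
  · subst h
    refine le_antisymm (Real.sSup_le ?_ le_rfl) (le_csSup (hbdd x x) ⟨0, hP, hR, by simp⟩)
    rintro _ ⟨φ, -, -, rfl⟩
    simp
  · refine csSup_le ⟨_, 0, hP, hR, rfl⟩ ?_
    rintro _ ⟨φ, hφP, hφR, rfl⟩
    exact (abs_sub_le _ (φ y) _).trans (add_le_add (le_csSup (hbdd x y) ⟨φ, hφP, hφR, rfl⟩)
      (le_csSup (hbdd y z) ⟨φ, hφP, hφR, rfl⟩))

lemma Connected.bddAbove_gamma (hconn : Connected b) (x y : X) :
    BddAbove {d : ℝ | ∃ φ : X → ℝ, FinSupp φ ∧ energy b c φ ≤ 1 ∧ d = |φ x - φ y|} := by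
  obtain ⟨C, hC⟩ := hconn.exists_abs_sub_le (c := c) x y
  refine ⟨C, ?_⟩
  rintro _ ⟨φ, -, hφ, rfl⟩
  exact hC φ hφ

lemma gammaO_set_subset (o x y : X) :
    {d : ℝ | ∃ φ : X → ℝ, FinSupp φ ∧
      energy b c φ + ENNReal.ofReal (φ o ^ 2) ≤ 1 ∧ d = |φ x - φ y|}
    ⊆ {d : ℝ | ∃ φ : X → ℝ, FinSupp φ ∧ energy b c φ ≤ 1 ∧ d = |φ x - φ y|} := by
  rintro _ ⟨φ, hφ, hle, rfl⟩
  exact ⟨φ, hφ, le_self_add.trans hle, rfl⟩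

/-- Finitely supported functions in the unit ball of `‖·‖_o` separate points. -/
lemma IsGraph.exists_separating (hg : IsGraph b c) (o : X) {x y : X} (hxy : x ≠ y) :
    ∃ φ : X → ℝ, FinSupp φ ∧ energy b c φ + ENNReal.ofReal (φ o ^ 2) ≤ 1 ∧ φ x ≠ φ y := by
  classical
  have hfin : FinSupp (Pi.single x (1 : ℝ)) :=
    (Set.finite_singleton x).subset Pi.support_single_subset
  obtain ⟨M, hM⟩ : ∃ M : ℝ, M = (energy b c (Pi.single x 1)).toReal
      + (Pi.single x (1 : ℝ) : X → ℝ) o ^ 2 := ⟨_, rfl⟩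
  have hM0 : 0 ≤ M := hM ▸ by positivity
  have hE : energy b c (Pi.single x 1)
      + ENNReal.ofReal ((Pi.single x (1 : ℝ) : X → ℝ) o ^ 2) = ENNReal.ofReal M := by
    rw [hM, ENNReal.ofReal_add ENNReal.toReal_nonneg (sq_nonneg _),
      ENNReal.ofReal_toReal (hg.energy_single_lt_top x 1).ne]
  refine ⟨(1 + M)⁻¹ • Pi.single x 1, hfin.smul _, ?_, ?_⟩
  · rw [energy_smul, Pi.smul_apply, smul_eq_mul, mul_pow, ENNReal.ofReal_mul (sq_nonneg _),
      ← mul_add, hE, ← ENNReal.ofReal_mul (sq_nonneg _)]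
    apply ENNReal.ofReal_le_one.2
    rw [inv_pow, inv_mul_le_iff₀ (by positivity)]
    nlinarith
  · simp [hxy.symm]
    positivity

lemma IsGraph.isMetric_gammaO (hg : IsGraph b c) (hconn : Connected b) (o : X) :
    IsMetric (gammaO b c o) :=
  isMetric_sSup_abs_sub (P := FinSupp)
    (R := fun φ => energy b c φ + ENNReal.ofReal (φ o ^ 2) ≤ 1) finSupp_zero
    (by simp [energy_zero])
    (fun x y => (hconn.bddAbove_gamma x y).mono (gammaO_set_subset o x y))
    (fun _ _ hxy => hg.exists_separating o hxy)

lemma IsGraph.isMetric_gamma (hg : IsGraph b c) (hconn : Connected b) :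
    IsMetric (gamma b c) := by
  refine isMetric_sSup_abs_sub (P := FinSupp) (R := fun φ => energy b c φ ≤ 1) finSupp_zero
    (by simp [energy_zero]) hconn.bddAbove_gamma fun x y hxy => ?_
  obtain ⟨φ, hφ, hle, hne⟩ := hg.exists_separating x hxy
  exact ⟨φ, hφ, le_self_add.trans hle, hne⟩

lemma Connected.gammaO_le_gamma (hconn : Connected b) (o x y : X) :
    gammaO b c o x y ≤ gamma b c x y :=
  csSup_le_csSup (hconn.bddAbove_gamma x y) ⟨_, 0, finSupp_zero, by simp [energy_zero], rfl⟩
    (gammaO_set_subset o x y)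

lemma Connected.gamma_eq_iSup_gammaO [Infinite X] (hconn : Connected b) (x y : X) :
    gamma b c x y = ⨆ o : X, gammaO b c o x y := by
  refine le_antisymm (csSup_le ⟨_, 0, finSupp_zero, by simp [energy_zero], rfl⟩ ?_)
    (ciSup_le fun o => hconn.gammaO_le_gamma o x y)
  rintro _ ⟨φ, hφ, hle, rfl⟩
  obtain ⟨o, ho⟩ := hφ.exists_notMem
  have hbdd : BddAbove (Set.range fun o => gammaO b c o x y) :=
    ⟨gamma b c x y, Set.forall_mem_range.2 fun o => hconn.gammaO_le_gamma o x y⟩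
  refine le_trans (le_csSup ((hconn.bddAbove_gamma x y).mono (gammaO_set_subset o x y))
    ⟨φ, hφ, ?_, rfl⟩) (le_ciSup hbdd o)
  simpa [Function.notMem_support.1 ho] using hle

lemma Connected.abs_sub_le_sqrt_mul_gamma (hconn : Connected b) {φ : X → ℝ} (hφ : FinSupp φ)
    {s : ℝ} (hs : 0 < s) (hle : energy b c φ ≤ ENNReal.ofReal s) (x y : X) :
    |φ x - φ y| ≤ √s * gamma b c x y := by
  have hs' : 0 < √s := Real.sqrt_pos.2 hs
  have hunit : energy b c ((√s)⁻¹ • φ) ≤ 1 := by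
    rw [energy_smul, inv_pow, Real.sq_sqrt hs.le]
    refine (mul_le_mul_right hle _).trans (le_of_eq ?_)
    rw [← ENNReal.ofReal_mul (inv_nonneg.2 hs.le), inv_mul_cancel₀ hs.ne', ENNReal.ofReal_one]
  have h := le_csSup (hconn.bddAbove_gamma (c := c) x y) ⟨_, hφ.smul _, hunit, rfl⟩
  rw [Pi.smul_apply, Pi.smul_apply, ← smul_sub, smul_eq_mul, abs_mul,
    abs_of_pos (inv_pos.2 hs'), inv_mul_le_iff₀ hs'] at h
  exact h

lemma IsGraph.energy_lt_top_of_memD0 (hg : IsGraph b c) {f : X → ℝ} (hf : MemD0 b c f) :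
    energy b c f < ⊤ := by
  obtain ⟨φ, hφ, -, hlim⟩ := hf
  obtain ⟨n, hn⟩ := (hlim.eventually (gt_mem_nhds ENNReal.zero_lt_top)).exists
  rw [← energy_neg] at hn
  simpa using hg.energy_add_lt_top (hg.energy_lt_top_of_finSupp (hφ n)) hn

lemma IsGraph.eventually_energy_lt (hg : IsGraph b c) {f : X → ℝ} {φ : ℕ → X → ℝ}
    (hlim : Tendsto (fun n => energy b c (φ n - f)) atTop (𝓝 0)) (hf : energy b c f < ⊤)
    {s : ℝ} (hs : (energy b c f).toReal < s) :
    ∀ᶠ n in atTop, energy b c (φ n) < ENNReal.ofReal s := by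
  obtain ⟨q, hq⟩ : ∃ q, q = (energy b c f).toReal := ⟨_, rfl⟩
  have hq0 : 0 ≤ q := hq ▸ ENNReal.toReal_nonneg
  rw [← hq] at hs
  obtain ⟨ε, hε, hεs⟩ : ∃ ε : ℝ, 0 < ε ∧ (1 + ε) * q < s := by
    refine ⟨(s - q) / (q + 1), div_pos (sub_pos.2 hs) (by positivity), ?_⟩
    have h : (s - q) / (q + 1) * (q + 1) = s - q := div_mul_cancel₀ _ (by positivity)
    have : 0 < (s - q) / (q + 1) := div_pos (sub_pos.2 hs) (by positivity)
    linarith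
  have hbound : Tendsto (fun n => ENNReal.ofReal (1 + ε) * energy b c f
      + ENNReal.ofReal (1 + ε⁻¹) * energy b c (φ n - f)) atTop
      (𝓝 (ENNReal.ofReal (1 + ε) * energy b c f + ENNReal.ofReal (1 + ε⁻¹) * 0)) :=
    tendsto_const_nhds.add (ENNReal.Tendsto.const_mul hlim (Or.inr ENNReal.ofReal_ne_top))
  have hlt : ENNReal.ofReal (1 + ε) * energy b c f + ENNReal.ofReal (1 + ε⁻¹) * 0
      < ENNReal.ofReal s := by
    rw [mul_zero, add_zero, ← ENNReal.ofReal_toReal hf.ne, ← hq,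
      ← ENNReal.ofReal_mul (by positivity)]
    exact (ENNReal.ofReal_lt_ofReal_iff (hq0.trans_lt hs)).2 hεs
  filter_upwards [hbound.eventually (gt_mem_nhds hlt)] with n hn
  simpa using (hg.energy_add_le hε f (φ n - f)).trans_lt hn

lemma IsGraph.abs_sub_le_of_memD0 (hg : IsGraph b c) (hconn : Connected b) {f : X → ℝ}
    (hf : MemD0 b c f) (x y : X) :
    |f x - f y| ≤ √(energy b c f).toReal * gamma b c x y := by
  have hfin := hg.energy_lt_top_of_memD0 hf
  obtain ⟨φ, hφ, hpt, hlim⟩ := hf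
  have hgt : ∀ s, (energy b c f).toReal < s → |f x - f y| ≤ √s * gamma b c x y := by
    intro s hs
    refine le_of_tendsto ((hpt x).sub (hpt y)).abs ?_
    filter_upwards [hg.eventually_energy_lt hlim hfin hs] with n hn
    exact hconn.abs_sub_le_sqrt_mul_gamma (hφ n) (ENNReal.toReal_nonneg.trans_lt hs) hn.le x y
  have hcont : Continuous fun s : ℝ => √s * gamma b c x y := by fun_prop
  refine ge_of_tendsto (hcont.tendsto _ |>.mono_left
    (nhdsWithin_le_nhds (s := Set.Ioi (energy b c f).toReal))) ?_
  filter_upwards [self_mem_nhdsWithin] with s hs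
  exact hgt s hs

end

end UTGraph

open UTGraph Filter Topology ENNReal in
/-- properties of `γ` and `γ_o`: both are metrics; every `f ∈ D₀`
satisfies `|f(x) - f(y)| ≤ Q(f)^{1/2} γ(x,y)`; `γ_o ≤ γ`; and `γ = sup_o γ_o`. -/
theorem stmt11 {X : Type*} [Countable X] [Infinite X]
    (b : X → X → ℝ) (c : X → ℝ) (hgraph : IsGraph b c) (hconn : Connected b) :
    (∀ o : X, IsMetric (gammaO b c o)) ∧
    IsMetric (gamma b c) ∧
    (∀ f : X → ℝ, MemD0 b c f → ∀ x y : X,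
      |f x - f y| ≤ Real.sqrt (energy b c f).toReal * gamma b c x y) ∧
    (∀ o x y : X, gammaO b c o x y ≤ gamma b c x y) ∧
    (∀ x y : X, gamma b c x y = ⨆ o : X, gammaO b c o x y) := by
  exact ⟨hgraph.isMetric_gammaO hconn, hgraph.isMetric_gamma hconn,
    fun _ hf => hgraph.abs_sub_le_of_memD0 hconn hf, hconn.gammaO_le_gamma,
    hconn.gamma_eq_iSup_gammaO⟩
end

section
/- Let (b,c) be a graph over a countably infinite set X. Then D ⊆ F, and for every f ∈ D and every g ∈ C_c(X) the Green's formula Q(f,g) = Σ_{x∈X} (𝓛f)(x)·g(x) holds. Furthermore, if (b,c) is connected and f ∈ D is harmonic, then Q(f,g) = 0 for every g ∈ D₀. -/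
open ENNReal Filter Topology

namespace UTGraph

variable {X : Type*}

section Green

variable {b : X → X → ℝ} {c f g : X → ℝ}

theorem IsGraph.edge_term_nonneg (h : IsGraph b c) (f : X → ℝ) (p : X × X) :
    0 ≤ b p.1 p.2 * (f p.1 - f p.2) ^ 2 :=
  mul_nonneg (h.nonneg _ _) (sq_nonneg _)

theorem IsGraph.potential_term_nonneg (h : IsGraph b c) (f : X → ℝ) (x : X) :
    0 ≤ c x * f x ^ 2 :=
  mul_nonneg (h.c_nonneg _) (sq_nonneg _)

theorem summable_of_tsum_ofReal_ne_top {ι : Type*} {u : ι → ℝ} (hu : ∀ i, 0 ≤ u i)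
    (h : ∑' i, ENNReal.ofReal (u i) ≠ ⊤) : Summable u :=
  (ENNReal.summable_toReal h).congr fun i => ENNReal.toReal_ofReal (hu i)

theorem FiniteEnergy.summable_edge (h : IsGraph b c) (hf : FiniteEnergy b c f) :
    Summable fun p : X × X => b p.1 p.2 * (f p.1 - f p.2) ^ 2 := by
  refine summable_of_tsum_ofReal_ne_top (h.edge_term_nonneg f) fun htop => ?_
  refine hf.ne ?_
  simp [energy, htop, ENNReal.mul_top]

theorem FiniteEnergy.summable_potential (h : IsGraph b c) (hf : FiniteEnergy b c f) :
    Summable fun x => c x * f x ^ 2 := by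
  refine summable_of_tsum_ofReal_ne_top (h.potential_term_nonneg f) fun htop => ?_
  refine hf.ne ?_
  simp [energy, htop]

theorem FiniteEnergy.toReal_energy (h : IsGraph b c) (hf : FiniteEnergy b c f) :
    (energy b c f).toReal =
      (1 / 2) * ∑' p : X × X, b p.1 p.2 * (f p.1 - f p.2) ^ 2 + ∑' x, c x * f x ^ 2 := by
  rw [energy, ← ENNReal.ofReal_tsum_of_nonneg (h.edge_term_nonneg f) (hf.summable_edge h),
    ← ENNReal.ofReal_tsum_of_nonneg (h.potential_term_nonneg f) (hf.summable_potential h),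
    ENNReal.toReal_add (ENNReal.mul_ne_top (by simp) ENNReal.ofReal_ne_top)
      ENNReal.ofReal_ne_top, ENNReal.toReal_mul,
    ENNReal.toReal_ofReal (tsum_nonneg (h.edge_term_nonneg f)),
    ENNReal.toReal_ofReal (tsum_nonneg (h.potential_term_nonneg f))]
  simp

/-- Finite energy functions have absolutely summable weighted differences along each row. -/
theorem FiniteEnergy.summable_row (h : IsGraph b c) (hf : FiniteEnergy b c f) (x : X) :
    Summable fun y => b x y * |f x - f y| := by
  have hs : Summable fun y => b x y * (f x - f y) ^ 2 :=
    (hf.summable_edge h).comp_injective (i := fun y => (x, y)) (Prod.mk_right_injective x)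
  refine Summable.of_nonneg_of_le (fun y => mul_nonneg (h.nonneg _ _) (abs_nonneg _))
    (fun y => ?_) ((h.row_summable x).add hs)
  have : |f x - f y| ≤ 1 + (f x - f y) ^ 2 := by
    nlinarith [sq_nonneg (|f x - f y| - 1), sq_abs (f x - f y), abs_nonneg (f x - f y)]
  nlinarith [mul_le_mul_of_nonneg_left this (h.nonneg x y)]

theorem FiniteEnergy.memF (h : IsGraph b c) (hf : FiniteEnergy b c f) : MemF b f := by
  intro x
  refine Summable.of_nonneg_of_le (fun y => mul_nonneg (h.nonneg _ _) (abs_nonneg _))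
    (fun y => ?_) (((h.row_summable x).mul_right |f x|).add (hf.summable_row h x))
  have : |f y| ≤ |f x| + |f x - f y| := by
    have := abs_sub (f x) (f x - f y)
    simpa using this
  nlinarith [mul_le_mul_of_nonneg_left this (h.nonneg x y)]

theorem FinSupp.summable_mul (hg : FinSupp g) (u : X → ℝ) : Summable fun x => u x * g x :=
  summable_of_hasFiniteSupport (hg.subset (Function.support_mul_subset_right u g))

theorem FiniteEnergy.summable_flow (h : IsGraph b c) (hf : FiniteEnergy b c f)
    (hg : FinSupp g) : Summable fun p : X × X => b p.1 p.2 * (f p.1 - f p.2) * g p.1 := by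
  have habs (p : X × X) : |b p.1 p.2 * (f p.1 - f p.2) * g p.1| =
      b p.1 p.2 * |f p.1 - f p.2| * |g p.1| := by
    rw [abs_mul, abs_mul, abs_of_nonneg (h.nonneg _ _)]
  refine Summable.of_abs ?_
  simp only [habs]
  have hnonneg : 0 ≤ fun p : X × X => b p.1 p.2 * |f p.1 - f p.2| * |g p.1| := fun p =>
    mul_nonneg (mul_nonneg (h.nonneg p.1 p.2) (abs_nonneg _)) (abs_nonneg _)
  have hg' : FinSupp fun x => |g x| := by
    simpa [FinSupp, Function.support] using hg
  refine (summable_prod_of_nonneg hnonneg).2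
    ⟨fun x => (hf.summable_row h x).mul_right |g x|, ?_⟩
  simp only [tsum_mul_right]
  exact hg'.summable_mul fun x => ∑' y, b x y * |f x - f y|

theorem IsGraph.edge_product_eq (h : IsGraph b c) (f g : X → ℝ) (p : X × X) :
    b p.1 p.2 * (f p.1 - f p.2) * (g p.1 - g p.2) =
      b p.1 p.2 * (f p.1 - f p.2) * g p.1 + b p.2 p.1 * (f p.2 - f p.1) * g p.2 := by
  rw [h.symm p.2 p.1]
  ring

theorem FiniteEnergy.summable_edge_product_of_finSupp (h : IsGraph b c)
    (hf : FiniteEnergy b c f) (hg : FinSupp g) :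
    Summable fun p : X × X => b p.1 p.2 * (f p.1 - f p.2) * (g p.1 - g p.2) := by
  simp only [h.edge_product_eq f g]
  exact (hf.summable_flow h hg).add (hf.summable_flow h hg).prod_symm

theorem FiniteEnergy.energyBilin_eq_tsum_formalLaplacian (h : IsGraph b c)
    (hf : FiniteEnergy b c f) (hg : FinSupp g) :
    energyBilin b c f g = ∑' x, formalLaplacian b c f x * g x := by
  have hs := hf.summable_flow h hg
  have hs' : Summable fun p : X × X => b p.2 p.1 * (f p.2 - f p.1) * g p.2 := hs.prod_symm
  have hswap : ∑' p : X × X, b p.2 p.1 * (f p.2 - f p.1) * g p.2 =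
      ∑' p : X × X, b p.1 p.2 * (f p.1 - f p.2) * g p.1 :=
    (Equiv.prodComm X X).tsum_eq fun p : X × X => b p.1 p.2 * (f p.1 - f p.2) * g p.1
  have hrows : ∑' p : X × X, b p.1 p.2 * (f p.1 - f p.2) * g p.1 =
      ∑' x, (∑' y, b x y * (f x - f y)) * g x := by
    rw [hs.tsum_prod]
    simp only [tsum_mul_right]
  rw [energyBilin]
  simp only [h.edge_product_eq f g, formalLaplacian, add_mul]
  rw [hs.tsum_add hs', hswap, hrows, (hg.summable_mul _).tsum_add (hg.summable_mul _)]
  ring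

theorem abs_weighted_mul_le {w u v t : ℝ} (hw : 0 ≤ w) (ht : 0 < t) :
    |w * u * v| ≤ t * (w * u ^ 2) + t⁻¹ * (w * v ^ 2) := by
  have key : |u * v| ≤ t * u ^ 2 + t⁻¹ * v ^ 2 := by
    have hp := mul_nonneg (inv_nonneg.2 ht.le) (sq_nonneg (t * |u| - |v|))
    have he : t⁻¹ * (t * |u| - |v|) ^ 2 = t * u ^ 2 + t⁻¹ * v ^ 2 - 2 * (|u| * |v|) := by
      rw [← sq_abs u, ← sq_abs v]
      field_simp
      ring
    rw [abs_mul]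
    nlinarith [mul_nonneg (abs_nonneg u) (abs_nonneg v)]
  rw [mul_assoc, abs_mul, abs_of_nonneg hw]
  nlinarith [mul_le_mul_of_nonneg_left key hw]

theorem FiniteEnergy.summable_edge_product (h : IsGraph b c) (hf : FiniteEnergy b c f)
    (hg : FiniteEnergy b c g) :
    Summable fun p : X × X => b p.1 p.2 * (f p.1 - f p.2) * (g p.1 - g p.2) :=
  Summable.of_norm_bounded
    (((hf.summable_edge h).mul_left 1).add ((hg.summable_edge h).mul_left 1⁻¹))
    fun _ => abs_weighted_mul_le (h.nonneg _ _) one_pos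

theorem FiniteEnergy.summable_potential_product (h : IsGraph b c) (hf : FiniteEnergy b c f)
    (hg : FiniteEnergy b c g) : Summable fun x => c x * f x * g x :=
  Summable.of_norm_bounded
    (((hf.summable_potential h).mul_left 1).add ((hg.summable_potential h).mul_left 1⁻¹))
    fun _ => abs_weighted_mul_le (h.c_nonneg _) one_pos

theorem FiniteEnergy.abs_energyBilin_le (h : IsGraph b c) (hf : FiniteEnergy b c f)
    (hg : FiniteEnergy b c g) {t : ℝ} (ht : 0 < t) :
    |energyBilin b c f g| ≤ t * (energy b c f).toReal + t⁻¹ * (energy b c g).toReal := by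
  have hedge := tsum_of_norm_bounded
    (f := fun p : X × X => b p.1 p.2 * (f p.1 - f p.2) * (g p.1 - g p.2))
    (((hf.summable_edge h).mul_left t).add ((hg.summable_edge h).mul_left t⁻¹)).hasSum
    fun p => abs_weighted_mul_le (u := f p.1 - f p.2) (v := g p.1 - g p.2)
      (h.nonneg p.1 p.2) ht
  have hpot := tsum_of_norm_bounded (f := fun x => c x * f x * g x)
    (((hf.summable_potential h).mul_left t).add ((hg.summable_potential h).mul_left t⁻¹)).hasSum
    fun x => abs_weighted_mul_le (u := f x) (v := g x) (h.c_nonneg x) ht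
  rw [((hf.summable_edge h).mul_left t).tsum_add ((hg.summable_edge h).mul_left t⁻¹),
    tsum_mul_left, tsum_mul_left, Real.norm_eq_abs] at hedge
  rw [((hf.summable_potential h).mul_left t).tsum_add ((hg.summable_potential h).mul_left t⁻¹),
    tsum_mul_left, tsum_mul_left, Real.norm_eq_abs] at hpot
  rw [hf.toReal_energy h, hg.toReal_energy h, energyBilin]
  refine (abs_add_le _ _).trans ?_
  rw [abs_mul, abs_of_nonneg (by norm_num : (0 : ℝ) ≤ 1 / 2)]
  linarith

theorem FiniteEnergy.energyBilin_eq_sub (h : IsGraph b c) (hf : FiniteEnergy b c f)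
    {φ : X → ℝ} (hφ : FinSupp φ) (hd : FiniteEnergy b c (φ - g)) :
    energyBilin b c f g = energyBilin b c f φ - energyBilin b c f (φ - g) := by
  have hedge := (hf.summable_edge_product_of_finSupp h hφ).tsum_sub
    (hf.summable_edge_product h hd)
  have hpot := (hφ.summable_mul fun x => c x * f x).tsum_sub
    (hf.summable_potential_product h hd)
  have hedge' (p : X × X) : b p.1 p.2 * (f p.1 - f p.2) * (g p.1 - g p.2) =
      b p.1 p.2 * (f p.1 - f p.2) * (φ p.1 - φ p.2) -
        b p.1 p.2 * (f p.1 - f p.2) * ((φ - g) p.1 - (φ - g) p.2) := by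
    simp only [Pi.sub_apply]
    ring
  have hpot' (x : X) : c x * f x * g x = c x * f x * φ x - c x * f x * (φ - g) x := by
    simp only [Pi.sub_apply]
    ring
  simp only [energyBilin]
  rw [tsum_congr hedge', tsum_congr hpot', hedge, hpot]
  ring

theorem Harmonic.energyBilin_eq_zero (h : IsGraph b c) (hf : FiniteEnergy b c f)
    (hharm : Harmonic b c f) (hg : MemD0 b c g) : energyBilin b c f g = 0 := by
  obtain ⟨φ, hφ, -, hlim⟩ := hg
  have hlim' : Tendsto (fun n => (energy b c (φ n - g)).toReal) atTop (𝓝 0) := by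
    exact (ENNReal.tendsto_toReal ENNReal.zero_ne_top).comp hlim
  have hle {t : ℝ} (ht : 0 < t) :
      |energyBilin b c f g| ≤ t * (energy b c f).toReal := by
    have hlim_t : Tendsto
        (fun n => t * (energy b c f).toReal + t⁻¹ * (energy b c (φ n - g)).toReal)
        atTop (𝓝 (t * (energy b c f).toReal)) := by
      simpa using (hlim'.const_mul t⁻¹).const_add (t * (energy b c f).toReal)
    refine ge_of_tendsto hlim_t ?_
    filter_upwards [hlim.eventually_lt_const ENNReal.zero_lt_top] with n hn
    have hzero : energyBilin b c f (φ n) = 0 := by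
      rw [hf.energyBilin_eq_tsum_formalLaplacian h (hφ n)]
      simp [hharm.2]
    rw [hf.energyBilin_eq_sub h (hφ n) hn, hzero, zero_sub, abs_neg]
    exact hf.abs_energyBilin_le h hn ht
  have hlim_zero : Tendsto (fun t : ℝ => t * (energy b c f).toReal) (𝓝[>] 0) (𝓝 0) := by
    have : Tendsto (fun t : ℝ => t * (energy b c f).toReal) (𝓝 0)
        (𝓝 (0 * (energy b c f).toReal)) := tendsto_id.mul_const _
    rw [zero_mul] at this
    exact this.mono_left nhdsWithin_le_nhds
  exact abs_nonpos_iff.1 (ge_of_tendsto hlim_zero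
    (by filter_upwards [self_mem_nhdsWithin] with t ht using hle ht))

end Green

end UTGraph

open UTGraph Filter Topology ENNReal in
/-- Green's formula: `D ⊆ F`; for `f ∈ D` and `g ∈ C_c(X)` one has
`Q(f,g) = Σ_x (𝓛f)(x) g(x)`; and for connected graphs, if `f ∈ D` is harmonic then
`Q(f,g) = 0` for all `g ∈ D₀`. -/
theorem stmt13 {X : Type*} [Countable X] [Infinite X]
    (b : X → X → ℝ) (c : X → ℝ) (hgraph : IsGraph b c) :
    (∀ f : X → ℝ, FiniteEnergy b c f → MemF b f) ∧
    (∀ f g : X → ℝ, FiniteEnergy b c f → FinSupp g →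
      energyBilin b c f g = ∑' x, formalLaplacian b c f x * g x) ∧
    (Connected b → ∀ f : X → ℝ, FiniteEnergy b c f → Harmonic b c f →
      ∀ g : X → ℝ, MemD0 b c g → energyBilin b c f g = 0) := by
  exact ⟨fun _ hf => hf.memF hgraph,
    fun _ _ hf hg => hf.energyBilin_eq_tsum_formalLaplacian hgraph hg,
    fun _ _ hf hharm _ hg => hharm.energyBilin_eq_zero hgraph hf hg⟩
end

section
/- Let (b,c) be a connected graph over a countably infinite set X. If f ∈ F is non-negative, not constant, and satisfies (𝓛f)(x) ≤ 0 for all x ∈ X, then f does not attain a maximum on X; that is, there is no x₀ ∈ X with f(x₀) = sup_{x∈X} f(x). -/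
open ENNReal Filter Topology

namespace UTGraph

/-- A subsolution takes the value of a nonnegative global maximum at every neighbour of a
maximum point. -/
theorem eq_of_adj_of_isMax {X : Type*} {b : X → X → ℝ} {c : X → ℝ} (hgraph : IsGraph b c)
    {f : X → ℝ} (hfF : MemF b f) {x y : X} (hx : 0 ≤ f x)
    (hsub : formalLaplacian b c f x ≤ 0) (hmax : ∀ z, f z ≤ f x) (hxy : 0 < b x y) :
    f y = f x := by
  have hsum : Summable fun z => b x z * (f x - f z) := by
    have habs : Summable fun z => b x z * f z := by
      refine Summable.of_abs ((hfF x).congr fun z => ?_)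
      rw [abs_mul, abs_of_nonneg (hgraph.nonneg x z)]
    simpa only [mul_sub] using ((hgraph.row_summable x).mul_right (f x)).sub habs
  have hle : b x y * (f x - f y) ≤ ∑' z, b x z * (f x - f z) :=
    hsum.le_tsum y fun z _ => mul_nonneg (hgraph.nonneg x z) (sub_nonneg.2 (hmax z))
  have hc : 0 ≤ c x * f x := mul_nonneg (hgraph.c_nonneg x) hx
  unfold formalLaplacian at hsub
  have hdiff : f x - f y ≤ 0 := nonpos_of_mul_nonpos_right (by linarith) hxy
  linarith [hmax y]

end UTGraph

open UTGraph Filter Topology ENNReal in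
/-- on a connected graph, a non-negative, non-constant `f ∈ F` with
`𝓛 f ≤ 0` does not attain a maximum. -/
theorem stmt14 {X : Type*} [Countable X] [Infinite X]
    (b : X → X → ℝ) (c : X → ℝ) (hgraph : IsGraph b c) (hconn : Connected b)
    (f : X → ℝ) (hfF : MemF b f) (hfpos : ∀ x, 0 ≤ f x)
    (hfnc : ¬ ∃ k : ℝ, ∀ x, f x = k)
    (hsub : ∀ x, formalLaplacian b c f x ≤ 0) :
    ¬ ∃ x₀ : X, ∀ x, f x ≤ f x₀ := by
  rintro ⟨x₀, hmax⟩
  refine hfnc ⟨f x₀, fun x => ?_⟩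
  induction hconn x₀ x with
  | refl => rfl
  | tail _ hadj ih =>
    rw [← ih]
    exact eq_of_adj_of_isMax hgraph hfF (hfpos _) (hsub _) (fun z => ih ▸ hmax z) hadj
end

section
/- Let (b,c) be a connected transient graph over a countably infinite set X (Royden decomposition). Then for every f ∈ D there exist unique f₀ ∈ D₀ and harmonic f_h ∈ D with f = f₀ + f_h. Moreover, if −a ≤ f ≤ b on X for some a, b ≥ 0, then −a ≤ f_h ≤ b on X; in particular, if f is bounded then f_h is bounded. -/
open ENNReal Filter Topology

namespace UTGraph

section Royden

/-- The weighted gradient of `f`, together with its weighted values: its `ℓ²`-norm squared is the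
energy of `f`. -/
noncomputable def weightedGradient (b : X → X → ℝ) (c : X → ℝ) :
    (X → ℝ) →ₗ[ℝ] ((X × X) ⊕ X → ℝ) where
  toFun f := Sum.elim (fun p => √(b p.1 p.2 / 2) * (f p.1 - f p.2)) (fun x => √(c x) * f x)
  map_add' f g := by
    ext (p | x) <;> simp <;> ring
  map_smul' t f := by
    ext (p | x) <;> simp <;> ring

/-- The space of functions of finite energy. -/
def energySpace (b : X → X → ℝ) (c : X → ℝ) : Submodule ℝ (X → ℝ) where
  carrier := {f | Memℓp (weightedGradient b c f) 2}
  add_mem' hf hg := by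
    simpa only [Set.mem_ofPred_eq, map_add] using hf.add hg
  zero_mem' := by
    simpa only [Set.mem_ofPred_eq, map_zero] using zero_memℓp
  smul_mem' t f hf := by
    simpa only [Set.mem_ofPred_eq, map_smul] using hf.const_smul t

/-- The weighted gradient as a linear map from the energy space to `ℓ²`. -/
noncomputable def energyEmbedding (b : X → X → ℝ) (c : X → ℝ) :
    energySpace b c →ₗ[ℝ] lp (fun _ : (X × X) ⊕ X => ℝ) 2 where
  toFun f := ⟨weightedGradient b c f, f.2⟩
  map_add' f g := lp.ext (map_add (weightedGradient b c) (f : X → ℝ) g)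
  map_smul' t f := lp.ext (map_smul (weightedGradient b c) t (f : X → ℝ))

variable {b : X → X → ℝ} {c : X → ℝ}

theorem energyEmbedding_inl (f : energySpace b c) (x y : X) :
    energyEmbedding b c f (.inl (x, y)) = √(b x y / 2) * (f.1 x - f.1 y) := rfl

theorem mem_energySpace_iff_summable {f : X → ℝ} :
    f ∈ energySpace b c ↔ Summable fun i => weightedGradient b c f i ^ 2 := by
  change Memℓp _ 2 ↔ _
  rw [memℓp_gen_iff (by simp)]
  simp

theorem norm_energyEmbedding_sq (f : energySpace b c) :
    ‖energyEmbedding b c f‖ ^ 2 = ∑' i, weightedGradient b c f i ^ 2 := by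
  simpa using! lp.norm_rpow_eq_tsum (p := 2) (by simp) (energyEmbedding b c f)

theorem energy_eq_tsum (h : IsGraph b c) (f : X → ℝ) :
    energy b c f = ∑' i, ENNReal.ofReal (weightedGradient b c f i ^ 2) := by
  rw [ENNReal.summable.tsum_sum ENNReal.summable, energy, ← ENNReal.tsum_mul_left]
  congr 1
  · refine tsum_congr fun p => ?_
    have hb : 0 ≤ b p.1 p.2 / 2 := by linarith [h.nonneg p.1 p.2]
    have h2 : (1 / 2 : ℝ≥0∞) = ENNReal.ofReal (1 / 2) := by
      rw [ENNReal.ofReal_div_of_pos two_pos]; simp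
    rw [h2, ← ENNReal.ofReal_mul (by norm_num)]
    congr 1
    simp only [weightedGradient, LinearMap.coe_mk, AddHom.coe_mk, Sum.elim_inl, mul_pow,
      Real.sq_sqrt hb]
    ring
  · refine tsum_congr fun x => ?_
    simp only [weightedGradient, LinearMap.coe_mk, AddHom.coe_mk, Sum.elim_inr, mul_pow,
      Real.sq_sqrt (h.c_nonneg x)]

theorem mem_energySpace_iff (h : IsGraph b c) {f : X → ℝ} :
    f ∈ energySpace b c ↔ FiniteEnergy b c f := by
  rw [mem_energySpace_iff_summable, FiniteEnergy, energy_eq_tsum h]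
  refine ⟨fun hs => ?_, fun hs => ?_⟩
  · rw [← ENNReal.ofReal_tsum_of_nonneg (fun i => sq_nonneg _) hs]
    exact ENNReal.ofReal_lt_top
  · simpa [ENNReal.toReal_ofReal, sq_nonneg] using ENNReal.summable_toReal hs.ne

theorem energy_coe (h : IsGraph b c) (f : energySpace b c) :
    energy b c f = ENNReal.ofReal (‖energyEmbedding b c f‖ ^ 2) := by
  rw [energy_eq_tsum h, norm_energyEmbedding_sq,
    ENNReal.ofReal_tsum_of_nonneg (fun i => sq_nonneg _) (mem_energySpace_iff_summable.1 f.2)]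

theorem tendsto_energy_sub_iff (h : IsGraph b c) (φ : ℕ → energySpace b c)
    (f : energySpace b c) :
    Tendsto (fun n => energy b c ((φ n : X → ℝ) - f)) atTop (𝓝 0) ↔
      Tendsto (fun n => energyEmbedding b c (φ n)) atTop (𝓝 (energyEmbedding b c f)) := by
  have key (n : ℕ) : energy b c ((φ n : X → ℝ) - f) =
      ENNReal.ofReal (‖energyEmbedding b c (φ n) - energyEmbedding b c f‖ ^ 2) := by
    rw [← map_sub, ← energy_coe h, Submodule.coe_sub]
  simp only [key]
  rw [tendsto_iff_norm_sub_tendsto_zero]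
  refine ⟨fun ht => ?_, fun ht => ?_⟩
  · have := (ENNReal.tendsto_toReal ENNReal.zero_ne_top).comp ht
    simpa [Function.comp_def, ENNReal.toReal_ofReal, sq_nonneg] using this.sqrt
  · simpa using ENNReal.tendsto_ofReal (ht.pow 2)

theorem summable_mul_sub (h : IsGraph b c) (f : energySpace b c) (x : X) :
    Summable fun y => b x y * |f.1 x - f.1 y| := by
  have hs : Summable fun y => b x y / 2 * (f.1 x - f.1 y) ^ 2 := by
    refine ((mem_energySpace_iff_summable.1 f.2).comp_injective
      (Sum.inl_injective.comp (Prod.mk_right_injective x))).congr fun y => ?_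
    have hb : 0 ≤ b x y / 2 := by linarith [h.nonneg x y]
    simp only [weightedGradient, LinearMap.coe_mk, AddHom.coe_mk, Function.comp_apply,
      Sum.elim_inl, mul_pow, Real.sq_sqrt hb]
  refine .of_nonneg_of_le (fun y => mul_nonneg (h.nonneg x y) (abs_nonneg _)) (fun y => ?_)
    (hs.add ((h.row_summable x).div_const 2))
  have := mul_nonneg (h.nonneg x y) (sq_nonneg (|f.1 x - f.1 y| - 1))
  rw [← sq_abs (f.1 x - f.1 y)]
  linarith

theorem memF_coe (h : IsGraph b c) (f : energySpace b c) : MemF b f := by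
  intro x
  refine .of_nonneg_of_le (fun y => mul_nonneg (h.nonneg x y) (abs_nonneg _)) (fun y => ?_)
    ((summable_mul_sub h f x).add ((h.row_summable x).mul_right |f.1 x|))
  rw [← mul_add]
  refine mul_le_mul_of_nonneg_left ?_ (h.nonneg x y)
  have := abs_sub_abs_le_abs_sub (f.1 y) (f.1 x)
  rw [abs_sub_comm] at this
  linarith

open Classical in
theorem single_mem_energySpace (h : IsGraph b c) (x : X) :
    (Pi.single x 1 : X → ℝ) ∈ energySpace b c := by
  rw [mem_energySpace_iff_summable]
  refine .sum _ ?_ ?_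
  · have h₁ : Summable fun p : X × X => if p.1 = x then b p.1 p.2 / 2 else 0 := by
      rw [← (Prod.mk_right_injective x).summable_iff]
      · simpa [Function.comp_def] using (h.row_summable x).div_const 2
      · rintro ⟨u, v⟩ huv
        refine if_neg fun hu => huv ⟨v, ?_⟩
        simp_all
    have h₂ := (Equiv.prodComm X X).summable_iff.2 h₁
    refine .of_nonneg_of_le (fun p => sq_nonneg _) (fun p => ?_) (h₁.add h₂)
    have hb : 0 ≤ b p.1 p.2 / 2 := by linarith [h.nonneg p.1 p.2]
    simp only [weightedGradient, LinearMap.coe_mk, AddHom.coe_mk, Sum.elim_inl, mul_pow,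
      Real.sq_sqrt hb, Function.comp_apply, Pi.single_apply, Equiv.prodComm_apply, Prod.fst_swap,
      Prod.snd_swap, h.symm p.2 p.1]
    split_ifs <;> (simp; try linarith)
  · refine summable_of_ne_finset_zero (s := {x}) fun y hy => ?_
    simp_all [weightedGradient]

theorem hasSum_inner_energyEmbedding (f g : energySpace b c) :
    HasSum (fun i => weightedGradient b c f i * weightedGradient b c g i)
      (inner ℝ (energyEmbedding b c f) (energyEmbedding b c g)) := by
  refine (lp.hasSum_inner (𝕜 := ℝ) (energyEmbedding b c f) (energyEmbedding b c g)).congr_fun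
    fun i => ?_
  exact mul_comm _ _

open Classical in
theorem inner_single_energyEmbedding (h : IsGraph b c) (f : energySpace b c) (x : X) :
    inner ℝ (energyEmbedding b c ⟨Pi.single x 1, single_mem_energySpace h x⟩)
      (energyEmbedding b c f) = formalLaplacian b c f x := by
  refine (hasSum_inner_energyEmbedding _ f).unique (HasSum.sum ?_ ?_)
  · have hs : HasSum (fun y => b x y * (f.1 x - f.1 y) / 2)
        ((∑' y, b x y * (f.1 x - f.1 y)) / 2) := by
      have : Summable fun y => b x y * (f.1 x - f.1 y) := by
        refine Summable.of_abs ((summable_mul_sub h f x).congr fun y => ?_)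
        rw [abs_mul, abs_of_nonneg (h.nonneg x y)]
      exact this.hasSum.div_const 2
    have h₁ : HasSum (fun p : X × X => if p.1 = x then b p.1 p.2 * (f.1 p.1 - f.1 p.2) / 2 else 0)
        ((∑' y, b x y * (f.1 x - f.1 y)) / 2) := by
      rw [← (Prod.mk_right_injective x).hasSum_iff]
      · simpa [Function.comp_def] using hs
      · rintro ⟨u, v⟩ huv
        refine if_neg fun hu => huv ⟨v, ?_⟩
        simp_all
    have h₂ := h₁.add ((Equiv.prodComm X X).hasSum_iff.2 h₁)
    rw [add_halves] at h₂
    refine h₂.congr_fun fun p => ?_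
    have hb : √(b p.1 p.2 / 2) * √(b p.1 p.2 / 2) = b p.1 p.2 / 2 :=
      Real.mul_self_sqrt (by linarith [h.nonneg p.1 p.2])
    simp only [weightedGradient, LinearMap.coe_mk, AddHom.coe_mk, Sum.elim_inl,
      Function.comp_apply, Pi.single_apply, Equiv.prodComm_apply, Prod.fst_swap,
      Prod.snd_swap, h.symm p.2 p.1]
    rw [mul_mul_mul_comm, hb]
    split_ifs <;> ring
  · have hc : √(c x) * √(c x) = c x := Real.mul_self_sqrt (h.c_nonneg x)
    have hval : c x * f.1 x =
        √(c x) * (Pi.single x 1 : X → ℝ) x * (√(c x) * f.1 x) := by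
      rw [Pi.single_eq_same, mul_one, ← mul_assoc, hc]
    rw [hval]
    refine hasSum_single x fun y hy => ?_
    simp [weightedGradient, hy]

theorem FinSupp.mem_energySpace (h : IsGraph b c) {φ : X → ℝ} (hφ : FinSupp φ) :
    φ ∈ energySpace b c := by
  classical
  have hφ : (Function.support φ).Finite := hφ
  have : φ = ∑ x ∈ hφ.toFinset, φ x • (Pi.single x 1 : X → ℝ) := by
    ext y
    simp +contextual [Finset.sum_apply, Pi.single_apply]
  rw [this]
  exact Submodule.sum_mem _ fun x _ => Submodule.smul_mem _ _ (single_mem_energySpace h x)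

theorem harmonic_coe_iff (h : IsGraph b c) (f : energySpace b c) :
    Harmonic b c f ↔ ∀ φ : energySpace b c, FinSupp φ.1 →
      inner ℝ (energyEmbedding b c φ) (energyEmbedding b c f) = 0 := by
  classical
  refine ⟨fun hf φ hφ => ?_, fun hf => ⟨memF_coe h f, fun x => ?_⟩⟩
  · have hφ : (Function.support φ.1).Finite := hφ
    have : φ = ∑ x ∈ hφ.toFinset, φ.1 x •
        (⟨Pi.single x 1, single_mem_energySpace h x⟩ : energySpace b c) := by
      ext y
      simp +contextual [Finset.sum_apply, Pi.single_apply]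
    rw [this, map_sum, sum_inner]
    refine Finset.sum_eq_zero fun x _ => ?_
    rw [map_smul, real_inner_smul_left, inner_single_energyEmbedding h, hf.2, mul_zero]
  · rw [← inner_single_energyEmbedding h]
    exact hf _ ((Set.finite_singleton x).subset Pi.support_single_subset)

theorem MemD0.exists_tendsto (h : IsGraph b c) {f : X → ℝ} (hf : MemD0 b c f) :
    ∃ (hf' : f ∈ energySpace b c) (φ : ℕ → energySpace b c), (∀ n, FinSupp (φ n).1) ∧
      (∀ x, Tendsto (fun n => (φ n).1 x) atTop (𝓝 (f x))) ∧
      Tendsto (fun n => energyEmbedding b c (φ n)) atTop (𝓝 (energyEmbedding b c ⟨f, hf'⟩)) := by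
  obtain ⟨φ, hφ, hx, hE⟩ := hf
  obtain ⟨n, hn⟩ := (hE.eventually_lt_const ENNReal.zero_lt_top).exists
  have hf' : f ∈ energySpace b c := by
    rw [← sub_sub_cancel (φ n) f]
    exact Submodule.sub_mem _ ((hφ n).mem_energySpace h) ((mem_energySpace_iff h).2 hn)
  let ψ : ℕ → energySpace b c := fun n => ⟨φ n, (hφ n).mem_energySpace h⟩
  exact ⟨hf', ψ, hφ, hx, (tendsto_energy_sub_iff h ψ ⟨f, hf'⟩).1 hE⟩

theorem memD0_of_tendsto (h : IsGraph b c) {f : energySpace b c} {φ : ℕ → energySpace b c}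
    (hφ : ∀ n, FinSupp (φ n).1) (hx : ∀ x, Tendsto (fun n => (φ n).1 x) atTop (𝓝 (f.1 x)))
    (hE : Tendsto (fun n => energyEmbedding b c (φ n)) atTop (𝓝 (energyEmbedding b c f))) :
    MemD0 b c f :=
  ⟨fun n => φ n, hφ, hx, (tendsto_energy_sub_iff h φ f).2 hE⟩

theorem inner_eq_zero_of_memD0 (h : IsGraph b c) {f₀ u : energySpace b c} (hf₀ : MemD0 b c f₀)
    (hu : Harmonic b c u) : inner ℝ (energyEmbedding b c f₀) (energyEmbedding b c u) = 0 := by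
  obtain ⟨_, φ, hφ, -, hE⟩ := hf₀.exists_tendsto h
  refine tendsto_nhds_unique (hE.inner tendsto_const_nhds) ?_
  simp only [(harmonic_coe_iff h u).1 hu _ (hφ _), tendsto_const_nhds]

theorem tendsto_of_reflTransGen {x y : X} (hxy : Relation.ReflTransGen (fun u v => 0 < b u v) x y)
    {φ : ℕ → energySpace b c} {t : ℝ} (hx : Tendsto (fun n => (φ n).1 x) atTop (𝓝 t))
    (hE : Tendsto (fun n => ‖energyEmbedding b c (φ n)‖) atTop (𝓝 0)) :
    Tendsto (fun n => (φ n).1 y) atTop (𝓝 t) := by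
  induction hxy with
  | refl => exact hx
  | @tail u v _ huv ih =>
    have hs : 0 < √(b u v / 2) := Real.sqrt_pos.2 (half_pos huv)
    have hd : Tendsto (fun n => (φ n).1 u - (φ n).1 v) atTop (𝓝 0) := by
      refine squeeze_zero_norm (fun n => ?_) (zero_div √(b u v / 2) ▸ hE.div_const _)
      rw [le_div_iff₀' hs]
      have := lp.norm_apply_le_norm two_ne_zero (energyEmbedding b c (φ n)) (.inl (u, v))
      rwa [energyEmbedding_inl, norm_mul, Real.norm_of_nonneg hs.le] at this
    simpa using ih.sub hd

theorem recurrent_of_tendsto (h : IsGraph b c) (hconn : Connected b) {x : X}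
    {φ : ℕ → energySpace b c} (hφ : ∀ n, FinSupp (φ n).1) (hx : ∀ n, (φ n).1 x = 1)
    (hE : Tendsto (fun n => ‖energyEmbedding b c (φ n)‖) atTop (𝓝 0)) : Recurrent b c := by
  have hlim (y : X) : Tendsto (fun n => (φ n).1 y) atTop (𝓝 1) :=
    tendsto_of_reflTransGen (hconn x y) (by simp [hx]) hE
  have hc (y : X) : c y = 0 := by
    have h₀ : Tendsto (fun n => √(c y) * (φ n).1 y) atTop (𝓝 0) :=
      squeeze_zero_norm (fun n =>
        lp.norm_apply_le_norm two_ne_zero (energyEmbedding b c (φ n)) (.inr y)) hE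
    have := tendsto_nhds_unique ((hlim y).const_mul √(c y)) h₀
    rwa [mul_one, Real.sqrt_eq_zero (h.c_nonneg y)] at this
  refine ⟨⟨fun n => φ n, hφ, hlim, ?_⟩, by simp [energy, hc]⟩
  have key (n : ℕ) : energy b c ((φ n : X → ℝ) - 1) =
      ENNReal.ofReal (‖energyEmbedding b c (φ n)‖ ^ 2) := by
    rw [← energy_coe h]
    simp [energy, hc]
  simp only [key]
  simpa using ENNReal.tendsto_ofReal (hE.pow 2)

theorem Transient.exists_abs_apply_le (h : IsGraph b c) (hconn : Connected b)
    (htrans : Transient b c) (x : X) :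
    ∃ C : ℝ, ∀ φ : energySpace b c, FinSupp φ.1 → |φ.1 x| ≤ C * ‖energyEmbedding b c φ‖ := by
  by_contra! hC
  choose φ hφ hlt using fun n : ℕ => hC (n + 1)
  have hpos (n : ℕ) : 0 < |(φ n).1 x| := lt_of_le_of_lt (by positivity) (hlt n)
  refine htrans (recurrent_of_tendsto h hconn (x := x) (φ := fun n => ((φ n).1 x)⁻¹ • φ n)
    (fun n => (hφ n).subset (Function.support_const_smul_subset _ _))
    (fun n => inv_mul_cancel₀ (abs_pos.1 (hpos n))) ?_)
  refine squeeze_zero (fun n => norm_nonneg _) (fun n => ?_)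
    tendsto_one_div_add_atTop_nhds_zero_nat
  rw [map_smul, norm_smul, norm_inv, Real.norm_eq_abs, inv_mul_eq_div, div_le_div_iff₀ (hpos n)
    (by positivity)]
  linarith [hlt n]

theorem Transient.tendsto_apply_zero (h : IsGraph b c) (hconn : Connected b)
    (htrans : Transient b c) {φ : ℕ → energySpace b c} (hφ : ∀ n, FinSupp (φ n).1)
    (hE : Tendsto (fun n => energyEmbedding b c (φ n)) atTop (𝓝 0)) (x : X) :
    Tendsto (fun n => (φ n).1 x) atTop (𝓝 0) := by
  obtain ⟨C, hC⟩ := htrans.exists_abs_apply_le h hconn x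
  exact squeeze_zero_norm (fun n => hC _ (hφ n)) (by simpa using hE.norm.const_mul C)

theorem FinSupp.sub {φ ψ : X → ℝ} (hφ : FinSupp φ) (hψ : FinSupp ψ) : FinSupp (φ - ψ) :=
  (hφ.union hψ).subset (Function.support_sub φ ψ)

theorem MemD0.sub (h : IsGraph b c) {f g : X → ℝ} (hf : MemD0 b c f) (hg : MemD0 b c g) :
    MemD0 b c (f - g) := by
  obtain ⟨hf', φ, hφ, hφx, hφE⟩ := hf.exists_tendsto h
  obtain ⟨hg', ψ, hψ, hψx, hψE⟩ := hg.exists_tendsto h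
  refine memD0_of_tendsto h (f := ⟨f, hf'⟩ - ⟨g, hg'⟩) (φ := fun n => φ n - ψ n)
    (fun n => (hφ n).sub (hψ n)) (fun x => (hφx x).sub (hψx x)) ?_
  simpa only [map_sub] using hφE.sub hψE

theorem Harmonic.sub (h : IsGraph b c) {u v : energySpace b c} (hu : Harmonic b c u)
    (hv : Harmonic b c v) : Harmonic b c (u - v).1 := by
  rw [harmonic_coe_iff h] at hu hv ⊢
  intro φ hφ
  rw [map_sub, inner_sub_right, hu φ hφ, hv φ hφ, sub_zero]

theorem Transient.exists_memD0_of_tendsto (h : IsGraph b c) (hconn : Connected b)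
    (htrans : Transient b c) {φ : ℕ → energySpace b c} (hφ : ∀ n, FinSupp (φ n).1)
    {k : lp (fun _ : (X × X) ⊕ X => ℝ) 2}
    (hE : Tendsto (fun n => energyEmbedding b c (φ n)) atTop (𝓝 k)) :
    ∃ f₀ : energySpace b c, MemD0 b c f₀ ∧ energyEmbedding b c f₀ = k := by
  have hlim (x : X) : ∃ t, Tendsto (fun n => (φ n).1 x) atTop (𝓝 t) := by
    obtain ⟨C, hC⟩ := htrans.exists_abs_apply_le h hconn x
    refine cauchySeq_tendsto_of_complete (cauchySeq_iff_tendsto_dist_atTop_0.2 ?_)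
    refine squeeze_zero (fun _ => dist_nonneg) (fun p => ?_)
      (by simpa using (cauchySeq_iff_tendsto_dist_atTop_0.1 hE.cauchySeq).const_mul C)
    simpa [dist_eq_norm] using hC (φ p.1 - φ p.2) ((hφ p.1).sub (hφ p.2))
  choose f₀ hf₀ using hlim
  have hk : weightedGradient b c f₀ = k := by
    ext i
    have h₁ : Tendsto (fun n => weightedGradient b c (φ n) i) atTop (𝓝 (k i)) :=
      ((lp.lipschitzWith_one_eval 2 i).continuous.tendsto k).comp hE
    refine tendsto_nhds_unique ?_ h₁
    rcases i with ⟨x, y⟩ | x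
    · exact ((hf₀ x).sub (hf₀ y)).const_mul _
    · exact (hf₀ x).const_mul _
  have hmem : f₀ ∈ energySpace b c := by
    change Memℓp (weightedGradient b c f₀) 2
    rw [hk]
    exact lp.memℓp k
  have hk' : energyEmbedding b c ⟨f₀, hmem⟩ = k := lp.ext hk
  exact ⟨⟨f₀, hmem⟩, memD0_of_tendsto h hφ hf₀ (hk' ▸ hE), hk'⟩

theorem Transient.exists_memD0_add_harmonic (h : IsGraph b c) (hconn : Connected b)
    (htrans : Transient b c) (f : energySpace b c) :
    ∃ f₀ u : energySpace b c, MemD0 b c f₀ ∧ Harmonic b c u ∧ f = f₀ + u := by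
  let S : Submodule ℝ (energySpace b c) :=
    { carrier := {φ | FinSupp φ.1}
      add_mem' := fun {φ ψ} hφ hψ => (hφ.union hψ).subset (Function.support_add φ.1 ψ.1)
      zero_mem' := by simp [FinSupp]
      smul_mem' := fun t φ hφ => hφ.subset (Function.support_const_smul_subset t φ.1) }
  obtain ⟨k, hk, z, hz, hfz⟩ := (S.map (energyEmbedding b c)).topologicalClosure
    |>.exists_add_mem_mem_orthogonal (energyEmbedding b c f)
  obtain ⟨v, hv, hvk⟩ := mem_closure_iff_seq_limit.1 hk
  choose φ hφ hφv using hv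
  obtain rfl : (fun n => energyEmbedding b c (φ n)) = v := funext hφv
  obtain ⟨f₀, hf₀, rfl⟩ := htrans.exists_memD0_of_tendsto h hconn hφ hvk
  refine ⟨f₀, f - f₀, hf₀, (harmonic_coe_iff h _).2 fun ψ hψ => ?_, by abel⟩
  rw [map_sub, hfz, add_sub_cancel_left]
  exact hz _ (Submodule.le_topologicalClosure _ ⟨ψ, hψ, rfl⟩)

theorem Transient.eq_zero_of_memD0_of_harmonic (h : IsGraph b c) (hconn : Connected b)
    (htrans : Transient b c) {f : X → ℝ} (hf : MemD0 b c f) (hharm : Harmonic b c f) : f = 0 := by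
  obtain ⟨hmem, φ, hφ, hx, hE⟩ := hf.exists_tendsto h
  have h₀ : energyEmbedding b c ⟨f, hmem⟩ = 0 :=
    inner_self_eq_zero.1 (inner_eq_zero_of_memD0 (f₀ := ⟨f, hmem⟩) (u := ⟨f, hmem⟩) h hf hharm)
  rw [h₀] at hE
  ext x
  exact tendsto_nhds_unique (hx x) (htrans.tendsto_apply_zero h hconn hφ hE x)

theorem abs_weightedGradient_comp_le {F : ℝ → ℝ} (hF : ∀ s t, |F s - F t| ≤ |s - t|)
    (hF₀ : ∀ s, |F s| ≤ |s|) (f : X → ℝ) (i : (X × X) ⊕ X) :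
    |weightedGradient b c (F ∘ f) i| ≤ |weightedGradient b c f i| := by
  rcases i with p | x
  · simpa [weightedGradient, abs_mul] using
      mul_le_mul_of_nonneg_left (hF (f p.1) (f p.2)) (abs_nonneg √(b p.1 p.2 / 2))
  · simpa [weightedGradient, abs_mul] using
      mul_le_mul_of_nonneg_left (hF₀ (f x)) (abs_nonneg √(c x))

theorem exists_norm_energyEmbedding_comp_le {F : ℝ → ℝ} (hF : ∀ s t, |F s - F t| ≤ |s - t|)
    (hF₀ : ∀ s, |F s| ≤ |s|) (f : energySpace b c) :
    ∃ g : energySpace b c, g.1 = F ∘ f.1 ∧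
      ‖energyEmbedding b c g‖ ≤ ‖energyEmbedding b c f‖ := by
  have hle := abs_weightedGradient_comp_le (b := b) (c := c) hF hF₀ f.1
  have hs := mem_energySpace_iff_summable.1 f.2
  have hmem : F ∘ f.1 ∈ energySpace b c := mem_energySpace_iff_summable.2
    (.of_nonneg_of_le (fun i => sq_nonneg _) (fun i => sq_le_sq.2 (hle i)) hs)
  refine ⟨⟨F ∘ f.1, hmem⟩, rfl, ?_⟩
  rw [← sq_le_sq₀ (norm_nonneg _) (norm_nonneg _), norm_energyEmbedding_sq,
    norm_energyEmbedding_sq]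
  exact (mem_energySpace_iff_summable.1 hmem).tsum_le_tsum (fun i => sq_le_sq.2 (hle i)) hs

theorem Transient.mem_Icc_of_memD0_add_harmonic (h : IsGraph b c) (hconn : Connected b)
    (htrans : Transient b c) {f f₀ u : energySpace b c} (hf₀ : MemD0 b c f₀)
    (hu : Harmonic b c u) (hf : f = f₀ + u) {a β : ℝ} (ha : 0 ≤ a) (hβ : 0 ≤ β)
    (hbd : ∀ x, f.1 x ∈ Set.Icc (-a) β) (x : X) : u.1 x ∈ Set.Icc (-a) β := by
  obtain ⟨_, φ, hφ, hx, hE⟩ := hf₀.exists_tendsto h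
  have hab : -a ≤ β := by linarith
  let F : ℝ → ℝ := fun s => Set.projIcc (-a) β hab s
  have hF_id {s : ℝ} (hs : s ∈ Set.Icc (-a) β) : F s = s := by
    simp [F, Set.projIcc_of_mem hab hs]
  have hF (s t : ℝ) : |F s - F t| ≤ |s - t| := Set.abs_projIcc_sub_projIcc hab
  have hF₀ (s : ℝ) : |F s| ≤ |s| := by
    simpa [hF_id ⟨neg_nonpos.2 ha, hβ⟩] using hF s 0
  choose v hv hvle using fun n => exists_norm_energyEmbedding_comp_le hF hF₀ (f - φ n)
  have hsupp (n : ℕ) : FinSupp (f - v n).1 := by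
    refine (hφ n).subset fun y hy => ?_
    contrapose! hy
    simp only [Function.mem_support, not_not] at hy
    simp [hv, hy, hF_id (hbd y)]
  have hpyth (n : ℕ) : ‖energyEmbedding b c (v n)‖ ^ 2 =
      ‖energyEmbedding b c u‖ ^ 2 + ‖energyEmbedding b c (v n - u)‖ ^ 2 := by
    have h₁ := inner_eq_zero_of_memD0 h hf₀ hu
    have h₂ := (harmonic_coe_iff h u).1 hu _ (hsupp n)
    have h₃ : v n = u + (f₀ - (f - v n)) := by rw [hf]; abel
    have h₄ : v n - u = f₀ - (f - v n) := by rw [hf]; abel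
    rw [h₄]
    nth_rw 1 [h₃]
    rw [map_add, norm_add_sq_real, map_sub, inner_sub_right, real_inner_comm, h₁,
      real_inner_comm, h₂]
    ring
  have hE' : Tendsto (fun n => energyEmbedding b c (f - φ n)) atTop
      (𝓝 (energyEmbedding b c u)) := by
    have := (tendsto_const_nhds (x := energyEmbedding b c f)).sub hE
    simpa only [map_sub, hf, map_add, add_sub_cancel_left] using this
  have hvu : Tendsto (fun n => energyEmbedding b c (v n - u)) atTop (𝓝 0) := by
    have hsq : Tendsto (fun n => ‖energyEmbedding b c (v n - u)‖ ^ 2) atTop (𝓝 0) := by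
      refine squeeze_zero (fun n => sq_nonneg _) (fun n => ?_)
        (sub_self (‖energyEmbedding b c u‖ ^ 2) ▸ (hE'.norm.pow 2).sub_const _)
      have := pow_le_pow_left₀ (norm_nonneg _) (hvle n) 2
      linarith [hpyth n]
    rw [tendsto_zero_iff_norm_tendsto_zero]
    simpa using hsq.sqrt
  have hdiff : Tendsto (fun n => ((f - v n) - φ n).1 x) atTop (𝓝 0) := by
    refine htrans.tendsto_apply_zero h hconn (fun n => (hsupp n).sub (hφ n)) ?_ x
    have := hE'.sub_const (energyEmbedding b c u) |>.sub hvu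
    refine (this.congr fun n => ?_).trans (by simp)
    rw [← map_sub, ← map_sub]
    congr 1
    abel
  have hlim : Tendsto (fun n => (v n).1 x) atTop (𝓝 (u.1 x)) := by
    have := ((tendsto_const_nhds (x := f.1 x)).sub (hx x)).sub hdiff
    refine (this.congr fun n => ?_).trans (by simp [hf])
    simp
  refine isClosed_Icc.mem_of_tendsto hlim (.of_forall fun n => ?_)
  rw [hv]
  exact Subtype.prop _

end Royden

end UTGraph

open UTGraph Filter Topology ENNReal in
/-- Royden decomposition: on a connected transient graph every
`f ∈ D` decomposes uniquely as `f = f₀ + f_h` with `f₀ ∈ D₀` and `f_h ∈ D`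
harmonic; moreover if `-a ≤ f ≤ β` with `a, β ≥ 0` then `-a ≤ f_h ≤ β`, and in
particular `f_h` is bounded whenever `f` is. -/
theorem stmt15 {X : Type*} [Countable X] [Infinite X]
    (b : X → X → ℝ) (c : X → ℝ) (hgraph : IsGraph b c) (hconn : Connected b)
    (htrans : Transient b c) (f : X → ℝ) (hf : FiniteEnergy b c f) :
    (∃ f₀ fh : X → ℝ, MemD0 b c f₀ ∧ FiniteEnergy b c fh ∧ Harmonic b c fh ∧
      f = f₀ + fh ∧
      (∀ a β : ℝ, 0 ≤ a → 0 ≤ β → (∀ x, -a ≤ f x ∧ f x ≤ β) →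
        ∀ x, -a ≤ fh x ∧ fh x ≤ β) ∧
      ((∃ M : ℝ, ∀ x, |f x| ≤ M) → ∃ M : ℝ, ∀ x, |fh x| ≤ M)) ∧
    (∀ f₀ fh g₀ gh : X → ℝ,
      MemD0 b c f₀ → FiniteEnergy b c fh → Harmonic b c fh → f = f₀ + fh →
      MemD0 b c g₀ → FiniteEnergy b c gh → Harmonic b c gh → f = g₀ + gh →
      f₀ = g₀ ∧ fh = gh) := by
  have hmem {g : X → ℝ} (hg : FiniteEnergy b c g) : g ∈ energySpace b c :=
    (mem_energySpace_iff hgraph).2 hg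
  refine ⟨?_, ?_⟩
  · obtain ⟨f₀, u, hf₀, hu, hfu⟩ :=
      htrans.exists_memD0_add_harmonic hgraph hconn ⟨f, hmem hf⟩
    have hbd (a β : ℝ) (ha : 0 ≤ a) (hβ : 0 ≤ β) (hfab : ∀ x, -a ≤ f x ∧ f x ≤ β) (x : X) :
        -a ≤ u.1 x ∧ u.1 x ≤ β :=
      htrans.mem_Icc_of_memD0_add_harmonic hgraph hconn hf₀ hu hfu ha hβ hfab x
    refine ⟨f₀, u, hf₀, (mem_energySpace_iff hgraph).1 u.2, hu, congrArg Subtype.val hfu, hbd, ?_⟩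
    rintro ⟨M, hM⟩
    have hM₀ : 0 ≤ M := (abs_nonneg _).trans (hM (Classical.arbitrary X))
    exact ⟨M, fun x => abs_le.2 (hbd M M hM₀ hM₀ (fun y => abs_le.1 (hM y)) x)⟩
  · intro f₀ fh g₀ gh hf₀ hfh hfh' hf_eq hg₀ hgh hgh' hg_eq
    have hdiff : f₀ - g₀ = gh - fh := by
      rw [sub_eq_sub_iff_add_eq_add, ← hf_eq, hg_eq, add_comm]
    have hharm : Harmonic b c (gh - fh) :=
      Harmonic.sub (u := ⟨gh, hmem hgh⟩) (v := ⟨fh, hmem hfh⟩) hgraph hgh' hfh'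
    have hzero : f₀ - g₀ = 0 :=
      htrans.eq_zero_of_memD0_of_harmonic hgraph hconn (hf₀.sub hgraph hg₀) (hdiff ▸ hharm)
    exact ⟨sub_eq_zero.1 hzero, (sub_eq_zero.1 (hdiff ▸ hzero)).symm⟩
end

section
/- Let (b,c) be a connected graph over a countably infinite set X. Then the constant function 1 belongs to D₀ if and only if Σ_{x∈X} c(x) < ∞ and the graph (b,0) (same edge weight b, potential identically zero) is recurrent. -/
open ENNReal Filter Topology

namespace UTGraph

variable {X : Type*} {b : X → X → ℝ} {c : X → ℝ}

/-- The energy for `(b, c)` splits as the energy for `(b, 0)` plus the potential part. -/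
lemma energy_eq_add_potential (b : X → X → ℝ) (c f : X → ℝ) :
    energy b c f = energy b (fun _ => 0) f + ∑' x, ENNReal.ofReal (c x * f x ^ 2) := by
  simp [energy]

lemma energy_zero_one (b : X → X → ℝ) : energy b (fun _ => 0) 1 = 0 := by
  simp [energy]

/-- Functions with smaller increments have smaller energy. -/
lemma energy_zero_mono (hb : ∀ x y, 0 ≤ b x y) {f g : X → ℝ}
    (h : ∀ x y, |f x - f y| ≤ |g x - g y|) :
    energy b (fun _ => 0) f ≤ energy b (fun _ => 0) g := by
  simp only [energy, zero_mul, ENNReal.ofReal_zero, tsum_zero, add_zero]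
  gcongr _ * ∑' p, ENNReal.ofReal ?_ with p
  exact mul_le_mul_of_nonneg_left (sq_le_sq.2 (h _ _)) (hb _ _)

/-- If `1 ∈ D₀`, the potential is summable. -/
lemma summable_of_memD0_one (hc : ∀ x, 0 ≤ c x) (h : MemD0 b c 1) : Summable c := by
  obtain ⟨φ, hfin, -, hlim⟩ := h
  obtain ⟨n, hn⟩ := (hlim.eventually (gt_mem_nhds ENNReal.zero_lt_top)).exists
  rw [energy_eq_add_potential] at hn
  have hsum := ENNReal.summable_toReal (ENNReal.add_lt_top.1 hn).2.ne
  refine (summable_congr_cofinite ?_).1 hsum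
  filter_upwards [(hfin n).compl_mem_cofinite] with x hx
  have hx0 : φ n x = 0 := by simpa using hx
  simp [hx0, ENNReal.toReal_ofReal (hc x)]

/-- If `1 ∈ D₀` for `(b, c)`, the graph `(b, 0)` is recurrent. -/
lemma recurrent_zero_of_memD0_one (h : MemD0 b c 1) : Recurrent b (fun _ => 0) := by
  obtain ⟨φ, hfin, hpt, hlim⟩ := h
  refine ⟨⟨φ, hfin, hpt, ?_⟩, energy_zero_one b⟩
  refine tendsto_of_tendsto_of_tendsto_of_le_of_le tendsto_const_nhds hlim
    (fun _ => zero_le) fun n => ?_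
  simp only [energy_eq_add_potential b c]
  exact le_self_add

/-- Truncating an approximation of `1` to `[0, 1]` makes the potential part converge. -/
lemma memD0_one_of_summable (hb : ∀ x y, 0 ≤ b x y) (hc : ∀ x, 0 ≤ c x) (hs : Summable c)
    (h : MemD0 b (fun _ => 0) 1) : MemD0 b c 1 := by
  obtain ⟨φ, hfin, hpt, hlim⟩ := h
  set ψ : ℕ → X → ℝ := fun n x => max 0 (min 1 (φ n x)) with hψ
  have hψpt : ∀ x, Tendsto (fun n => ψ n x) atTop (𝓝 1) := fun x => by
    simpa using tendsto_const_nhds.max (tendsto_const_nhds.min (hpt x) : Tendsto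
      (fun n => min (1 : ℝ) (φ n x)) atTop _) (f := fun _ => (0 : ℝ))
  refine ⟨ψ, fun n => (hfin n).subset fun x hx hx0 => hx (by simp [hψ, hx0]), hψpt, ?_⟩
  simp only [energy_eq_add_potential b c]
  rw [← add_zero (0 : ℝ≥0∞)]
  refine Tendsto.add ?_ ?_
  · refine tendsto_of_tendsto_of_tendsto_of_le_of_le tendsto_const_nhds hlim
      (fun _ => zero_le) fun n => energy_zero_mono hb fun x y => ?_
    simp only [hψ, Pi.sub_apply, Pi.one_apply, sub_sub_sub_cancel_right]
    calc |max 0 (min 1 (φ n x)) - max 0 (min 1 (φ n y))|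
        ≤ |min 1 (φ n x) - min 1 (φ n y)| := by
          simpa using abs_max_sub_max_le_max 0 (min 1 (φ n x)) 0 (min 1 (φ n y))
      _ ≤ |φ n x - φ n y| := by
          simpa using abs_min_sub_min_le_max 1 (φ n x) 1 (φ n y)
  · have hsq : ∀ n x, (ψ n x - 1) ^ 2 ≤ 1 := fun n x => by
      have h0 : 0 ≤ ψ n x := le_max_left _ _
      have h1 : ψ n x ≤ 1 := max_le zero_le_one (min_le_left _ _)
      nlinarith
    have hnonneg : ∀ n x, 0 ≤ c x * (ψ n x - 1) ^ 2 :=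
      fun n x => mul_nonneg (hc x) (sq_nonneg _)
    have hle : ∀ n x, c x * (ψ n x - 1) ^ 2 ≤ c x :=
      fun n x => mul_le_of_le_one_right (hc x) (hsq n x)
    have hreal : Tendsto (fun n => ∑' x, c x * (ψ n x - 1) ^ 2) atTop (𝓝 0) := by
      rw [← tsum_zero (α := ℝ) (β := X)]
      refine tendsto_tsum_of_dominated_convergence hs (fun x => ?_)
        (Eventually.of_forall fun n x => ?_)
      · simpa using (((hψpt x).sub_const 1).pow 2).const_mul (c x)
      · rw [Real.norm_of_nonneg (hnonneg n x)]
        exact hle n x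
    have := ENNReal.tendsto_ofReal hreal
    rw [ENNReal.ofReal_zero] at this
    refine this.congr fun n => ?_
    exact ENNReal.ofReal_tsum_of_nonneg (hnonneg n)
      (hs.of_nonneg_of_le (hnonneg n) (hle n))

end UTGraph

open UTGraph Filter Topology ENNReal in
/-- on a connected graph, the constant function `1` belongs to `D₀`
if and only if `c ∈ ℓ¹(X)` and the graph `(b,0)` is recurrent. -/
theorem stmt16 {X : Type*} [Countable X] [Infinite X]
    (b : X → X → ℝ) (c : X → ℝ) (hgraph : IsGraph b c) (hconn : Connected b) :
    MemD0 b c 1 ↔ (Summable c ∧ Recurrent b (fun _ => 0)) := by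
  constructor
  · exact fun h => ⟨summable_of_memD0_one hgraph.c_nonneg h, recurrent_zero_of_memD0_one h⟩
  · exact fun h => memD0_one_of_summable hgraph.nonneg hgraph.c_nonneg h.1 h.2.1
end
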